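/- arXiv:math/0411294 — 3 statements merged into one kernel-verified Lean document; each statement's English description precedes it below -/
import Mathlib

section
/- Let m ≥ 1 be an integer. There exists a constant c > 0, depending only on m, such that for every real κ ≥ 0, ∫_{M_m(ℝ)} det(I + v vᵀ)^{−κ−m} dv = c · ∏_{j=1}^{m} Γ(κ + j/2) / Γ(κ + (m+j)/2), where dv is Lebesgue measure on M_m(ℝ) ≅ ℝ^{m²}. -/
open MeasureTheory Matrix

open scoped MatrixOrder in
lemma hua_row {n : ℕ} (A : Matrix (Fin n) (Fin n) ℝ) (hA : A.PosDef) (s : ℝ) :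
    ∫⁻ x : Fin n → ℝ, ENNReal.ofReal ((A + vecMulVec x x).det ^ (-s))
      = ENNReal.ofReal (A.det ^ (1 / 2 - s)) *
        ∫⁻ y : Fin n → ℝ, ENNReal.ofReal ((1 + y ⬝ᵥ y) ^ (-s)) := by
  have hdet := hA.det_pos
  obtain ⟨B, hB⟩ := CStarAlgebra.nonneg_iff_eq_star_mul_self.mp hA.posSemidef.nonneg
  have hB' : A = Bᵀ * B := by rw [hB, star_eq_conjTranspose, conjTranspose_eq_transpose_of_trivial]
  have hd : A.det = B.det ^ 2 := by rw [hB', det_mul, det_transpose]; ring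
  have hB0 : B.det ≠ 0 := by
    intro h; rw [hd, h] at hdet; simp at hdet
  have hBt : Bᵀ.det ≠ 0 := by rwa [det_transpose]
  have hmeas : Measurable fun x : Fin n → ℝ => ENNReal.ofReal ((A + vecMulVec x x).det ^ (-s)) := by
    have : Continuous fun x : Fin n → ℝ => (A + vecMulVec x x).det := by
      apply Continuous.matrix_det
      exact continuous_const.add (Continuous.matrix_vecMulVec continuous_id continuous_id)
    exact (this.measurable.pow_const _).ennreal_ofReal
  have hmap := Real.map_matrix_volume_pi_eq_smul_volume_pi hBt
  have h1 : ∫⁻ y : Fin n → ℝ, ENNReal.ofReal ((A + vecMulVec (Bᵀ *ᵥ y) (Bᵀ *ᵥ y)).det ^ (-s))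
      = ENNReal.ofReal |(Bᵀ.det)⁻¹| *
        ∫⁻ x : Fin n → ℝ, ENNReal.ofReal ((A + vecMulVec x x).det ^ (-s)) := by
    rw [← smul_eq_mul, ← lintegral_smul_measure, ← hmap, lintegral_map hmeas]
    · simp
    · exact (LinearMap.continuous_on_pi _).measurable
  have h2 : ∀ y : Fin n → ℝ, (A + vecMulVec (Bᵀ *ᵥ y) (Bᵀ *ᵥ y)).det = A.det * (1 + y ⬝ᵥ y) := by
    intro y
    have : A + vecMulVec (Bᵀ *ᵥ y) (Bᵀ *ᵥ y)
        = Bᵀ * (1 + replicateCol Unit y * replicateRow Unit y) * B := by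
      rw [Matrix.mul_add, Matrix.add_mul, Matrix.mul_one, ← hB', ← vecMulVec_eq,
        mul_vecMulVec, vecMulVec_mul, mulVec_transpose]
    rw [this, det_mul, det_mul, det_transpose, hd, det_one_add_mul_comm]
    simp [replicateRow_mul_replicateCol_apply]
    ring
  have hy : ∀ y : Fin n → ℝ, 0 ≤ 1 + y ⬝ᵥ y := by
    intro y
    have : 0 ≤ y ⬝ᵥ y := by
      simpa using dotProduct_star_self_nonneg y
    linarith
  have h3 : ENNReal.ofReal |Bᵀ.det| * ENNReal.ofReal |(Bᵀ.det)⁻¹| = 1 := by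
    rw [← ENNReal.ofReal_mul (abs_nonneg _), ← abs_mul, mul_inv_cancel₀ hBt]; simp
  have h4 : |Bᵀ.det| * A.det ^ (-s) = A.det ^ (1 / 2 - s) := by
    rw [sub_eq_add_neg, Real.rpow_add hdet, ← Real.sqrt_eq_rpow, det_transpose]
    congr 1
    rw [hd, Real.sqrt_sq_eq_abs]
  calc _ = ENNReal.ofReal |Bᵀ.det| * ∫⁻ y : Fin n → ℝ,
        ENNReal.ofReal ((A + vecMulVec (Bᵀ *ᵥ y) (Bᵀ *ᵥ y)).det ^ (-s)) := by
        rw [h1, ← mul_assoc, h3, one_mul]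
    _ = ENNReal.ofReal |Bᵀ.det| * (ENNReal.ofReal (A.det ^ (-s)) *
        ∫⁻ y : Fin n → ℝ, ENNReal.ofReal ((1 + y ⬝ᵥ y) ^ (-s))) := by
        congr 1
        rw [← lintegral_const_mul' _ _ ENNReal.ofReal_ne_top]
        refine lintegral_congr fun y => ?_
        rw [h2, Real.mul_rpow hdet.le (hy y), ENNReal.ofReal_mul (by positivity)]
    _ = _ := by
        rw [← mul_assoc, ← ENNReal.ofReal_mul (abs_nonneg _), h4]

lemma hua_rec (n : ℕ) : ∀ (k : ℕ) (s : ℝ),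
    ∫⁻ v : Fin k → Fin n → ℝ, ENNReal.ofReal ((1 + (Matrix.of v)ᵀ * Matrix.of v).det ^ (-s))
      = ∏ i ∈ Finset.range k,
        ∫⁻ y : Fin n → ℝ, ENNReal.ofReal ((1 + y ⬝ᵥ y) ^ (-(s - i / 2))) := by
  intro k
  induction k with
  | zero =>
    intro s
    simp [volume_pi]
  | succ k ih =>
    intro s
    have hcont : Continuous fun v : Fin (k+1) → Fin n → ℝ =>
        (1 + (Matrix.of v)ᵀ * Matrix.of v).det := by
      apply Continuous.matrix_det
      have h : Continuous fun v : Fin (k+1) → Fin n → ℝ => Matrix.of v := continuous_id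
      exact continuous_const.add (h.matrix_transpose.matrix_mul h)
    have hmeas : Measurable fun v : Fin (k+1) → Fin n → ℝ =>
        ENNReal.ofReal ((1 + (Matrix.of v)ᵀ * Matrix.of v).det ^ (-s)) :=
      (hcont.measurable.pow_const _).ennreal_ofReal
    have hmp := (volume_preserving_piFinSuccAbove (fun _ : Fin (k+1) => Fin n → ℝ) 0).symm
    rw [← hmp.lintegral_comp hmeas, Measure.volume_eq_prod, lintegral_prod_symm']
    swap
    · exact hmeas.comp (MeasurableEquiv.measurable _)
    have key : ∀ (w : Fin k → Fin n → ℝ) (x : Fin n → ℝ),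
        1 + (Matrix.of ((MeasurableEquiv.piFinSuccAbove (fun _ : Fin (k+1) => Fin n → ℝ) 0).symm (x, w)))ᵀ
          * Matrix.of ((MeasurableEquiv.piFinSuccAbove (fun _ : Fin (k+1) => Fin n → ℝ) 0).symm (x, w))
          = (1 + (Matrix.of w)ᵀ * Matrix.of w) + vecMulVec x x := by
      intro w x
      rw [add_assoc]
      congr 1
      ext i j
      simp [Matrix.mul_apply, Fin.sum_univ_succ, vecMulVec_apply, MeasurableEquiv.piFinSuccAbove, add_comm]
    have hpd : ∀ w : Fin k → Fin n → ℝ, (1 + (Matrix.of w)ᵀ * Matrix.of w).PosDef := by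
      intro w
      have := posSemidef_conjTranspose_mul_self (Matrix.of w)
      rw [conjTranspose_eq_transpose_of_trivial] at this
      exact PosDef.one.add_posSemidef this
    simp_rw [key]
    have hstep : ∀ w : Fin k → Fin n → ℝ, _ := fun w => hua_row _ (hpd w) s
    simp_rw [hstep]
    have hcont' : Continuous fun v : Fin k → Fin n → ℝ =>
        (1 + (Matrix.of v)ᵀ * Matrix.of v).det := by
      apply Continuous.matrix_det
      have h : Continuous fun v : Fin k → Fin n → ℝ => Matrix.of v := continuous_id
      exact continuous_const.add (h.matrix_transpose.matrix_mul h)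
    rw [lintegral_mul_const _ (hcont'.measurable.pow_const _).ennreal_ofReal]
    have := ih (s - 1 / 2)
    rw [neg_sub] at this
    rw [this, Finset.prod_range_succ']
    congr 1
    · refine Finset.prod_congr rfl fun i _ => ?_
      refine lintegral_congr fun y => ?_
      congr 3
      push_cast; ring
    · simp

lemma hua_base (n : ℕ) (s : ℝ) (hs : (n : ℝ) / 2 < s) :
    ∫⁻ y : Fin n → ℝ, ENNReal.ofReal ((1 + y ⬝ᵥ y) ^ (-s))
      = ENNReal.ofReal (Real.pi ^ ((n : ℝ) / 2) * (Real.Gamma (s - n / 2) / Real.Gamma s)) := by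
  have hn : (0 : ℝ) ≤ (n : ℝ) / 2 := by positivity
  have hs0 : 0 < s := by linarith
  have hG := Real.Gamma_pos_of_pos hs0
  have hG' := Real.Gamma_pos_of_pos (sub_pos.2 hs)
  -- the Gamma integral as a lower Lebesgue integral
  have gam : ∀ a r : ℝ, 0 < a → 0 < r →
      ∫⁻ t in Set.Ioi (0 : ℝ), ENNReal.ofReal (t ^ (a - 1) * Real.exp (-(r * t)))
        = ENNReal.ofReal ((1 / r) ^ a * Real.Gamma a) := by
    intro a r ha hr
    have h := Real.integral_rpow_mul_exp_neg_mul_Ioi ha hr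
    have hp := Real.Gamma_pos_of_pos ha
    rw [← h, ofReal_integral_eq_lintegral_ofReal]
    · exact .of_integral_ne_zero (by rw [h]; positivity)
    · filter_upwards [self_mem_ae_restrict measurableSet_Ioi] with t ht
      have : (0 : ℝ) < t := ht
      positivity
  have gauss : ∀ t : ℝ, 0 < t →
      ∫⁻ y : Fin n → ℝ, ENNReal.ofReal (Real.exp (-((y ⬝ᵥ y) * t)))
        = ENNReal.ofReal ((Real.pi / t) ^ ((n : ℝ) / 2)) := by
    intro t ht
    have h := GaussianFourier.integral_rexp_neg_mul_sq_norm (V := EuclideanSpace ℝ (Fin n)) ht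
    rw [finrank_euclideanSpace_fin] at h
    have hp := Real.pi_pos
    rw [← h, ofReal_integral_eq_lintegral_ofReal
      (.of_integral_ne_zero (by rw [h]; positivity)) (ae_of_all _ fun _ => by positivity),
      ← (PiLp.volume_preserving_toLp (Fin n)).lintegral_comp (by fun_prop)]
    refine lintegral_congr fun y => ?_
    congr 2
    rw [EuclideanSpace.norm_sq_eq]
    simp [dotProduct, mul_comm, pow_two]
  have hy : ∀ y : Fin n → ℝ, 0 < 1 + y ⬝ᵥ y := by
    intro y
    have : 0 ≤ y ⬝ᵥ y := by
      simpa using dotProduct_star_self_nonneg y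
    linarith
  have main : ENNReal.ofReal (Real.Gamma s) *
      ∫⁻ y : Fin n → ℝ, ENNReal.ofReal ((1 + y ⬝ᵥ y) ^ (-s))
      = ENNReal.ofReal (Real.pi ^ ((n : ℝ) / 2) * Real.Gamma (s - n / 2)) := by
    calc _ = ∫⁻ y : Fin n → ℝ, ∫⁻ t in Set.Ioi (0 : ℝ),
          ENNReal.ofReal (t ^ (s - 1) * Real.exp (-((1 + y ⬝ᵥ y) * t))) := by
          rw [← lintegral_const_mul' _ _ ENNReal.ofReal_ne_top]
          refine lintegral_congr fun y => ?_
          rw [gam s _ hs0 (hy y), ← ENNReal.ofReal_mul hG.le, one_div,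
            Real.inv_rpow (hy y).le, Real.rpow_neg (hy y).le, mul_comm]
      _ = ∫⁻ t in Set.Ioi (0 : ℝ), ∫⁻ y : Fin n → ℝ,
          ENNReal.ofReal (t ^ (s - 1) * Real.exp (-((1 + y ⬝ᵥ y) * t))) := by
          apply lintegral_lintegral_swap
          apply Measurable.aemeasurable
          apply Measurable.ennreal_ofReal
          apply Measurable.mul
          · exact measurable_snd.pow_const _
          · apply Continuous.measurable
            simp only [dotProduct]
            fun_prop
      _ = ∫⁻ t in Set.Ioi (0 : ℝ), ENNReal.ofReal (Real.pi ^ ((n : ℝ) / 2)) *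
            ENNReal.ofReal (t ^ ((s - n / 2) - 1) * Real.exp (-(1 * t))) := by
          refine setLIntegral_congr_fun measurableSet_Ioi fun t ht => ?_
          have ht : (0 : ℝ) < t := ht
          have e : ∀ y : Fin n → ℝ,
              ENNReal.ofReal (t ^ (s - 1) * Real.exp (-((1 + y ⬝ᵥ y) * t)))
              = ENNReal.ofReal (t ^ (s - 1) * Real.exp (-(1 * t))) *
                ENNReal.ofReal (Real.exp (-((y ⬝ᵥ y) * t))) := by
            intro y
            rw [← ENNReal.ofReal_mul (by positivity), mul_assoc, ← Real.exp_add]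
            congr 3; ring
          simp_rw [e]
          rw [lintegral_const_mul' _ _ ENNReal.ofReal_ne_top, gauss t ht,
            ← ENNReal.ofReal_mul (by positivity), ← ENNReal.ofReal_mul (by positivity)]
          congr 1
          rw [Real.div_rpow Real.pi_pos.le ht.le,
            show s - n / 2 - 1 = (s - 1) - n / 2 by ring, Real.rpow_sub ht (s - 1)]
          ring
      _ = _ := by
          rw [lintegral_const_mul' _ _ ENNReal.ofReal_ne_top, gam _ _ (sub_pos.2 hs) one_pos,
            ← ENNReal.ofReal_mul (by positivity)]
          simp
  have hG0 : ENNReal.ofReal (Real.Gamma s) ≠ 0 := by simpa using hG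
  rw [← ENNReal.mul_right_inj hG0 ENNReal.ofReal_ne_top, main, ← ENNReal.ofReal_mul hG.le]
  congr 1
  field_simp

/-- The Hua integral for `V = M_m(ℝ)`: there is a constant `c > 0` depending only on
`m` such that for every `κ ≥ 0`,
`∫_{M_m(ℝ)} det(I + vvᵀ)^{−κ−m} dv = c ∏_{j=1}^m Γ(κ+j/2)/Γ(κ+(m+j)/2)`. -/
theorem hua_integral_matrices (m : ℕ) (hm : 1 ≤ m) :
    ∃ c : ℝ, 0 < c ∧ ∀ κ : ℝ, 0 ≤ κ →
      (∫ v : Fin m → Fin m → ℝ,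
          ((1 + Matrix.of v * (Matrix.of v)ᵀ).det) ^ (-κ - m))
        = c * ∏ j ∈ Finset.range m,
            Real.Gamma (κ + ((j : ℝ) + 1) / 2)
              / Real.Gamma (κ + ((m : ℝ) + (j : ℝ) + 1) / 2) := by
  refine ⟨(Real.pi ^ ((m : ℝ) / 2)) ^ m, by have := Real.pi_pos; positivity, fun κ hκ => ?_⟩
  have hpd : ∀ w : Fin m → Fin m → ℝ, (1 + (Matrix.of w)ᵀ * Matrix.of w).PosDef := by
    intro w
    have := posSemidef_conjTranspose_mul_self (Matrix.of w)
    rw [conjTranspose_eq_transpose_of_trivial] at this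
    exact PosDef.one.add_posSemidef this
  have hcont : Continuous fun v : Fin m → Fin m → ℝ =>
      (1 + (Matrix.of v)ᵀ * Matrix.of v).det := by
    apply Continuous.matrix_det
    have h : Continuous fun v : Fin m → Fin m → ℝ => Matrix.of v := continuous_id
    exact continuous_const.add (h.matrix_transpose.matrix_mul h)
  simp_rw [det_one_add_mul_comm (Matrix.of _) (Matrix.of _)ᵀ]
  rw [integral_eq_lintegral_of_nonneg_ae
    (ae_of_all _ fun v => Real.rpow_nonneg (hpd v).det_pos.le _)
    (hcont.measurable.pow_const _).aestronglyMeasurable,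
    show -κ - m = -(κ + m) by ring, hua_rec]
  have hb : ∀ i ∈ Finset.range m, (m : ℝ) / 2 < κ + m - i / 2 := by
    intro i hi
    have : (i : ℝ) < m := by exact_mod_cast Finset.mem_range.1 hi
    linarith
  rw [Finset.prod_congr rfl fun i hi => hua_base m _ (hb i hi), ENNReal.toReal_prod]
  have hv : ∀ i ∈ Finset.range m, (ENNReal.ofReal (Real.pi ^ ((m : ℝ) / 2) *
      (Real.Gamma (κ + m - i / 2 - m / 2) / Real.Gamma (κ + m - i / 2)))).toReal
      = Real.pi ^ ((m : ℝ) / 2) *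
      (Real.Gamma (κ + m - i / 2 - m / 2) / Real.Gamma (κ + m - i / 2)) := by
    intro i hi
    have h1 := hb i hi
    have h2 : (0 : ℝ) ≤ (m : ℝ) / 2 := by positivity
    have := Real.Gamma_pos_of_pos (sub_pos.2 h1)
    have := Real.Gamma_pos_of_pos (h2.trans_lt h1)
    have := Real.pi_pos
    exact ENNReal.toReal_ofReal (by positivity)
  rw [Finset.prod_congr rfl hv, Finset.prod_mul_distrib, Finset.prod_const, Finset.card_range]
  congr 1
  rw [← Finset.prod_range_reflect]
  refine Finset.prod_congr rfl fun j hj => ?_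
  have hj' := Finset.mem_range.1 hj
  have : ((m - 1 - j : ℕ) : ℝ) = m - 1 - j := by
    rw [Nat.cast_sub (by omega), Nat.cast_sub hm]; simp
  rw [this]
  congr 2 <;> ring
end

section
/- Let n ≥ 1 be an integer, let H = {(x₀,x₁) ∈ ℝ × ℝ^{n−1} : x₀ > 0}, and for real ν > n − 1 define the Berezin kernel B_ν(x,y) = ( 4 x₀ y₀ / ((x₀+y₀)² + ‖x₁−y₁‖²) )^{ν} for x = (x₀,x₁), y = (y₀,y₁) ∈ H. Then B_ν is a positive definite kernel on H: for every N ≥ 1, all points x¹, …, x^N ∈ H and all complex numbers c₁, …, c_N, Σ_{i,j=1}^{N} c_i \overline{c_j} B_ν(xⁱ, xʲ) ≥ 0. -/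
open scoped ComplexOrder

/-- Positive semidefinite kernels on a finite index set. -/
def PSDKer {N : ℕ} (K : Fin N → Fin N → ℂ) : Prop :=
  ∀ c : Fin N → ℂ, 0 ≤ ∑ i, ∑ j, c i * (starRingEnd ℂ) (c j) * K i j

lemma PSDKer.rankOne {N : ℕ} (f : Fin N → ℂ) :
    PSDKer (fun i j => f i * (starRingEnd ℂ) (f j)) := by
  intro c
  have : ∑ i, ∑ j, c i * (starRingEnd ℂ) (c j) * (f i * (starRingEnd ℂ) (f j))
      = (∑ i, c i * f i) * (starRingEnd ℂ) (∑ i, c i * f i) := by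
    rw [map_sum, Finset.sum_mul_sum]
    refine Finset.sum_congr rfl fun i _ => Finset.sum_congr rfl fun j _ => ?_
    rw [map_mul]; ring
  rw [this, Complex.mul_conj]
  exact_mod_cast Complex.normSq_nonneg _

lemma PSDKer.mulRankOne {N : ℕ} {K : Fin N → Fin N → ℂ} (hK : PSDKer K) (f : Fin N → ℂ) :
    PSDKer (fun i j => f i * (starRingEnd ℂ) (f j) * K i j) := by
  intro c
  have h := hK (fun i => c i * f i)
  refine h.trans_eq ?_
  refine Finset.sum_congr rfl fun i _ => Finset.sum_congr rfl fun j _ => ?_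
  rw [map_mul]; ring

lemma PSDKer.smul {N : ℕ} {K : Fin N → Fin N → ℂ} (hK : PSDKer K) {a : ℝ} (ha : 0 ≤ a) :
    PSDKer (fun i j => (a : ℂ) * K i j) := by
  intro c
  have h := mul_nonneg (show (0 : ℂ) ≤ (a : ℂ) by exact_mod_cast ha) (hK c)
  refine h.trans_eq ?_
  simp only [Finset.mul_sum]
  refine Finset.sum_congr rfl fun i _ => Finset.sum_congr rfl fun j _ => ?_
  ring

lemma PSDKer.integral {N : ℕ} {α : Type*} [MeasurableSpace α] (μ : MeasureTheory.Measure α)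
    (K : α → Fin N → Fin N → ℂ)
    (hint : ∀ i j, MeasureTheory.Integrable (fun t => K t i j) μ)
    (hK : ∀ᵐ t ∂μ, PSDKer (K t)) :
    PSDKer (fun i j => ∫ t, K t i j ∂μ) := by
  intro c
  have : ∑ i, ∑ j, c i * (starRingEnd ℂ) (c j) * ∫ t, K t i j ∂μ
      = ∫ t, ∑ i, ∑ j, c i * (starRingEnd ℂ) (c j) * K t i j ∂μ := by
    rw [MeasureTheory.integral_finsetSum]
    · refine Finset.sum_congr rfl fun i _ => ?_
      rw [MeasureTheory.integral_finsetSum]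
      · refine Finset.sum_congr rfl fun j _ => ?_
        rw [MeasureTheory.integral_const_mul]
      · intro j _
        exact (hint i j).const_mul _
    · intro i _
      exact MeasureTheory.integrable_finsetSum _ fun j _ => (hint i j).const_mul _
  rw [this]
  refine MeasureTheory.integral_nonneg_of_ae ?_
  filter_upwards [hK] with t ht using ht c

lemma PSDKer.gamma {N : ℕ} {a : ℝ} (ha : 0 < a) (r : Fin N → Fin N → ℝ)
    (hr : ∀ i j, 0 < r i j) (K : Fin N → Fin N → ℂ)
    (h : ∀ t : ℝ, 0 < t → PSDKer (fun i j => (Real.exp (-(r i j * t)) : ℂ) * K i j)) :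
    PSDKer (fun i j => (((1 / r i j) ^ a : ℝ) : ℂ) * K i j) := by
  have key := fun i j => Real.integral_rpow_mul_exp_neg_mul_Ioi ha (hr i j)
  have hG : 0 < Real.Gamma a := Real.Gamma_pos_of_pos ha
  have hint : ∀ i j, MeasureTheory.IntegrableOn
      (fun t : ℝ => t ^ (a - 1) * Real.exp (-(r i j * t))) (Set.Ioi 0) := by
    intro i j
    refine MeasureTheory.Integrable.of_integral_ne_zero ?_
    rw [key i j]
    have := hr i j
    positivity
  have h1 := PSDKer.integral (MeasureTheory.volume.restrict (Set.Ioi (0 : ℝ)))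
    (fun t i j => ((t ^ (a - 1) * Real.exp (-(r i j * t)) : ℝ) : ℂ) * K i j)
    (fun i j => (hint i j).ofReal.mul_const _) (by
      refine (MeasureTheory.ae_restrict_iff' measurableSet_Ioi).2 (.of_forall fun t ht => ?_)
      have h2 := (h t ht).smul (Real.rpow_nonneg (le_of_lt ht) (a - 1))
      convert h2 using 3
      push_cast; ring)
  have h3 := h1.smul (inv_nonneg.2 hG.le)
  convert h3 using 3 with i j
  rw [MeasureTheory.integral_mul_const, integral_complex_ofReal, key i j]
  have : (Real.Gamma a : ℂ) ≠ 0 := by exact_mod_cast hG.ne'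
  push_cast
  field_simp

lemma PSDKer.gauss {N m : ℕ} (x : Fin N → ℝ × EuclideanSpace ℝ (Fin m))
    (hx : ∀ i, 0 < (x i).1) {t : ℝ} (ht : 0 < t) :
    PSDKer (fun i j => (((1 / ((x i).1 + (x j).1)) ^ ((m : ℝ) / 2)
      * Real.exp (-(‖(x i).2 - (x j).2‖ ^ 2 / ((x i).1 + (x j).1) * t)) : ℝ) : ℂ)) := by
  have hs : ∀ i j, 0 < (x i).1 + (x j).1 := fun i j => add_pos (hx i) (hx j)
  have hs' : ∀ i j, 0 < (((x i).1 + (x j).1 : ℝ) : ℂ).re := fun i j => hs i j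
  set q : ℂ := Complex.I * (2 * Real.sqrt t : ℝ) with hq
  have hq2 : q ^ 2 = -(4 * t : ℝ) := by
    rw [hq, mul_pow, Complex.I_sq, ← Complex.ofReal_pow, mul_pow, Real.sq_sqrt ht.le]
    push_cast; ring
  have h1 := PSDKer.integral (MeasureTheory.volume : MeasureTheory.Measure (EuclideanSpace ℝ (Fin m)))
    (fun v i j => Complex.exp (-(((x i).1 + (x j).1 : ℝ) : ℂ) * ‖v‖ ^ 2
      + q * (inner ℝ ((x i).2 - (x j).2) v : ℝ)))
    (fun i j => GaussianFourier.integrable_cexp_neg_mul_sq_norm_add (hs' i j) q _)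
    (.of_forall fun v => by
      have := PSDKer.rankOne (fun i => Complex.exp (-((x i).1 : ℂ) * ‖v‖ ^ 2
        + q * (inner ℝ (x i).2 v : ℝ)))
      convert this using 3 with i j
      rw [← Complex.exp_conj, ← Complex.exp_add]
      congr 1
      have h2 : (starRingEnd ℂ) (2 : ℂ) = 2 := Complex.conj_ofNat 2
      simp [hq, inner_sub_left, h2]
      ring)
  have hpi : (0 : ℝ) ≤ ((1 / Real.pi) ^ ((m : ℝ) / 2)) := by positivity
  have h2 := h1.smul hpi
  convert h2 using 3 with i j
  have hsij := hs i j
  rw [GaussianFourier.integral_cexp_neg_mul_sq_norm_add (hs' i j), hq2, finrank_euclideanSpace_fin]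
  have e1 : ((Real.pi : ℂ) / (((x i).1 + (x j).1 : ℝ) : ℂ)) ^ ((m : ℂ) / 2)
      = (((Real.pi / ((x i).1 + (x j).1)) ^ ((m : ℝ) / 2) : ℝ) : ℂ) := by
    rw [Complex.ofReal_cpow (by positivity)]
    push_cast; rfl
  rw [e1, ← mul_assoc, ← Complex.ofReal_mul, ← Real.mul_rpow (by positivity) (by positivity),
    Complex.ofReal_mul, Complex.ofReal_exp]
  congr 3
  · congr 1
    field_simp
  · have : (((x i).1 + (x j).1 : ℝ) : ℂ) ≠ 0 := by exact_mod_cast hsij.ne'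
    push_cast at this ⊢
    field_simp

/-- Positive definiteness of the Berezin kernel
`B_ν(x,y) = (4x₀y₀/((x₀+y₀)²+‖x₁−y₁‖²))^ν` on the half-space
`H = {(x₀,x₁) : x₀ > 0}` for `ν > n−1`. -/
theorem berezin_kernel_posDef_hyperbolic (n : ℕ) (hn : 1 ≤ n) (ν : ℝ)
    (hν : (n : ℝ) - 1 < ν)
    (B : ℝ × EuclideanSpace ℝ (Fin (n - 1)) → ℝ × EuclideanSpace ℝ (Fin (n - 1)) → ℝ)
    (hB : ∀ x y, B x y
      = (4 * x.1 * y.1 / ((x.1 + y.1) ^ 2 + ‖x.2 - y.2‖ ^ 2)) ^ ν) :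
    ∀ (N : ℕ), 1 ≤ N →
      ∀ (x : Fin N → ℝ × EuclideanSpace ℝ (Fin (n - 1))),
        (∀ i, 0 < (x i).1) →
        ∀ c : Fin N → ℂ,
          0 ≤ ∑ i, ∑ j, c i * (starRingEnd ℂ) (c j) * (B (x i) (x j) : ℂ) := by
  intro N _ x hx
  have hs : ∀ i j, 0 < (x i).1 + (x j).1 := fun i j => add_pos (hx i) (hx j)
  have hm : ((n - 1 : ℕ) : ℝ) = (n : ℝ) - 1 := by push_cast [hn]; ring
  have hm0 : (0 : ℝ) ≤ ((n - 1 : ℕ) : ℝ) := Nat.cast_nonneg _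
  have ha : 0 < ν - ((n - 1 : ℕ) : ℝ) / 2 := by linarith
  have hν0 : 0 < ν := by linarith
  have hexp : ∀ t : ℝ, ∀ {K : Fin N → Fin N → ℂ}, PSDKer K →
      PSDKer (fun i j => (Real.exp (-(((x i).1 + (x j).1) * t)) : ℂ) * K i j) := by
    intro t K hK
    have := hK.mulRankOne (fun i => (Real.exp (-((x i).1 * t)) : ℂ))
    convert this using 3 with i j
    rw [Complex.conj_ofReal, ← Complex.ofReal_mul, ← Real.exp_add]
    congr 3
    ring
  have hB' := PSDKer.gamma hν0
    (fun i j => ((x i).1 + (x j).1) + ‖(x i).2 - (x j).2‖ ^ 2 / ((x i).1 + (x j).1))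
    (fun i j => by have := hs i j; positivity)
    (fun i j => (((1 / ((x i).1 + (x j).1)) ^ ν : ℝ) : ℂ)) (by
      intro t ht
      have h1 := hexp t (PSDKer.gamma ha (fun i j => (x i).1 + (x j).1) hs _
        (fun u _ => hexp u (PSDKer.gauss x hx ht)))
      convert h1 using 3 with i j
      have := hs i j
      simp only [← Complex.ofReal_mul]
      congr 1
      rw [← mul_assoc ((1 / ((x i).1 + (x j).1)) ^ (ν - ((n - 1 : ℕ) : ℝ) / 2)),
        ← Real.rpow_add (by positivity), sub_add_cancel, add_mul, neg_add, Real.exp_add]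
      ring)
  have h3 := hB'.mulRankOne (fun i => (((2 * (x i).1) ^ ν : ℝ) : ℂ))
  intro c
  refine (h3 c).trans_eq ?_
  refine Finset.sum_congr rfl fun i _ => Finset.sum_congr rfl fun j _ => ?_
  have := hs i j
  have hi := hx i
  have hj := hx j
  congr 1
  beta_reduce
  rw [hB, Complex.conj_ofReal]
  simp only [← Complex.ofReal_mul]
  congr 1
  rw [← Real.mul_rpow (by positivity) (by positivity),
    ← Real.mul_rpow (by positivity) (by positivity),
    ← Real.mul_rpow (by positivity) (by positivity)]
  congr 1
  field_simp
  ring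
end

section
/- Let n ≥ 1 be an integer, H = {(x₀,x₁) ∈ ℝ × ℝ^{n−1} : x₀ > 0} with measure μ(dx) = x₀^{−n} dx₀ dx₁, and for ν > n−1 set ψ_ν(x) = (4x₀/((1+x₀)²+‖x₁‖²))^ν, I(ν) = ∫_H ψ_ν dμ (which is finite), and B_ν(x,y) = (4x₀y₀/((x₀+y₀)²+‖x₁−y₁‖²))^ν. Then for every continuous compactly supported function f : H → ℂ, lim_{ν→∞} (1/I(ν)) ∫_H ∫_H B_ν(x,y) f(x) \overline{f(y)} μ(dx) μ(dy) = ∫_H |f(x)|² μ(dx). -/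
open MeasureTheory Filter Topology

lemma peak_rpow {X : Type*} [TopologicalSpace X] [MeasurableSpace X] [BorelSpace X]
    (μ : Measure X) (s : Set X) (hs : MeasurableSet s) (hfin : μ s ≠ ⊤) (x₀ : X)
    (c : X → ℝ) (hcm : Measurable c) (hc0 : ∀ x ∈ s, 0 ≤ c x) (hc1 : ∀ x ∈ s, c x ≤ 1)
    (hcx : c x₀ = 1) (hcc : ContinuousAt c x₀)
    (hout : ∀ u : Set X, IsOpen u → x₀ ∈ u → ∃ t, 0 ≤ t ∧ t < 1 ∧ ∀ x ∈ s \ u, c x ≤ t)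
    (hμ : ∀ u, IsOpen u → x₀ ∈ u → 0 < μ (u ∩ s))
    (g : X → ℂ) (hmg : IntegrableOn g s μ) (hcg : ContinuousAt g x₀) :
    Tendsto (fun ν : ℝ => (∫ x in s, c x ^ ν ∂μ)⁻¹ • ∫ x in s, c x ^ ν • g x ∂μ)
      atTop (𝓝 (g x₀)) := by
  let φ : ℝ → X → ℝ := fun n x => (∫ x in s, c x ^ n ∂μ)⁻¹ * c x ^ n
  have hnφ : ∀ n, ∀ x ∈ s, 0 ≤ φ n x := by
    intro n x hx
    apply mul_nonneg (inv_nonneg.2 _) (Real.rpow_nonneg (hc0 x hx) _)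
    exact setIntegral_nonneg hs fun x hx => Real.rpow_nonneg (hc0 x hx) _
  have I : ∀ n : ℝ, 0 ≤ n → IntegrableOn (fun x => c x ^ n) s μ := fun n hn => by
    refine Measure.integrableOn_of_bounded (M := 1) hfin
      (Measurable.aestronglyMeasurable (by fun_prop)) ?_
    filter_upwards [ae_restrict_mem hs] with x hx
    rw [Real.norm_of_nonneg (Real.rpow_nonneg (hc0 x hx) _)]
    exact Real.rpow_le_one (hc0 x hx) (hc1 x hx) hn
  have J : ∀ n : ℝ, 0 ≤ᵐ[μ.restrict s] fun x => c x ^ n := by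
    intro n
    filter_upwards [ae_restrict_mem hs] with x hx
    exact Real.rpow_nonneg (hc0 x hx) n
  have key : ∀ t' : ℝ, 0 < t' → t' < 1 → ∃ m : ℝ, 0 < m ∧ ∀ n : ℝ, 0 ≤ n →
      t' ^ n * m ≤ ∫ y in s, c y ^ n ∂μ := by
    intro t' t'_pos t'1
    obtain ⟨v, hv, v_open, x₀_v⟩ := mem_nhds_iff.1
      (hcc.eventually (lt_mem_nhds (a := t') (by rw [hcx]; exact t'1)))
    have hvs : μ (v ∩ s) ≠ ⊤ := ((measure_mono Set.inter_subset_right).trans_lt hfin.lt_top).ne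
    refine ⟨μ.real (v ∩ s), ENNReal.toReal_pos (hμ v v_open x₀_v).ne' hvs, fun n hn => ?_⟩
    calc
      t' ^ n * μ.real (v ∩ s) = ∫ _ in v ∩ s, t' ^ n ∂μ := by simp [mul_comm]
      _ ≤ ∫ y in v ∩ s, c y ^ n ∂μ := by
        apply setIntegral_mono_on _ _ (v_open.measurableSet.inter hs) _
        · exact integrableOn_const (C := t' ^ n) hvs
        · exact (I n hn).mono Set.inter_subset_right le_rfl
        · intro x hx
          exact Real.rpow_le_rpow t'_pos.le (le_of_lt (hv hx.1)) hn
      _ ≤ ∫ y in s, c y ^ n ∂μ :=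
        setIntegral_mono_set (I n hn) (J n) (Eventually.of_forall Set.inter_subset_right)
  have P : ∀ n : ℝ, 0 ≤ n → (0 : ℝ) < ∫ x in s, c x ^ n ∂μ := by
    intro n hn
    obtain ⟨m, hm, h⟩ := key (1/2) (by norm_num) (by norm_num)
    exact lt_of_lt_of_le (by positivity) (h n hn)
  have A : ∀ u : Set X, IsOpen u → x₀ ∈ u → TendstoUniformlyOn φ 0 atTop (s \ u) := by
    intro u u_open x₀u
    obtain ⟨t, t_pos, tx₀, ht⟩ := hout u u_open x₀u
    obtain ⟨t', tt', t'x₀⟩ : ∃ t', t < t' ∧ t' < 1 := exists_between tx₀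
    have t'_pos : 0 < t' := t_pos.trans_lt tt'
    obtain ⟨m, hm, hB⟩ := key t' t'_pos t'x₀
    have M : ∀ n : ℝ, 0 ≤ n → ∀ x ∈ s \ u, φ n x ≤ m⁻¹ * (t / t') ^ n := by
      intro n hn x hx
      have B := hB n hn
      simp_rw [φ, ← div_eq_inv_mul, Real.div_rpow t_pos t'_pos.le, div_div]
      have h1 : c x ^ n ≤ t ^ n := Real.rpow_le_rpow (hc0 x hx.1) (ht x hx) hn
      have h2 : 0 ≤ c x ^ n := Real.rpow_nonneg (hc0 x hx.1) _
      have h3 : 0 < t' ^ n := Real.rpow_pos_of_pos t'_pos n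
      gcongr
    have N : Tendsto (fun n : ℝ => m⁻¹ * (t / t') ^ n) atTop (𝓝 (m⁻¹ * 0)) := by
      apply Tendsto.mul tendsto_const_nhds _
      apply tendsto_rpow_atTop_of_base_lt_one
      · have := div_nonneg t_pos t'_pos.le
        linarith
      · exact (div_lt_one t'_pos).2 tt'
    rw [mul_zero] at N
    refine Metric.tendstoUniformlyOn_iff.2 fun ε εpos => ?_
    filter_upwards [(tendsto_order.1 N).2 ε εpos, eventually_ge_atTop 0] with n hn hn0 x hx
    simp only [Pi.zero_apply, dist_zero_left, Real.norm_of_nonneg (hnφ n x hx.1)]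
    exact (M n hn0 x hx).trans_lt hn
  have : Tendsto (fun i : ℝ => ∫ x in s, φ i x • g x ∂μ) atTop (𝓝 (g x₀)) := by
    have B : Tendsto (fun i ↦ ∫ x in s, φ i x ∂μ) atTop (𝓝 1) := by
      refine tendsto_const_nhds.congr' ?_
      filter_upwards [eventually_ge_atTop 0] with n hn
      rw [integral_const_mul, inv_mul_cancel₀ (P n hn).ne']
    have C : ∀ᶠ i in atTop, AEStronglyMeasurable (fun x ↦ φ i x) (μ.restrict s) :=
      Eventually.of_forall fun n ↦ Measurable.aestronglyMeasurable (by fun_prop)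
    exact tendsto_setIntegral_peak_smul_of_integrableOn_of_tendsto hs
      hs (Set.Subset.rfl) (self_mem_nhdsWithin)
      hfin (Eventually.of_forall hnφ) A B C hmg (hcg.mono_left nhdsWithin_le_nhds)
  convert! this
  simp_rw [φ, ← smul_smul, integral_smul]

abbrev EE (n : ℕ) := ℝ × EuclideanSpace ℝ (Fin (n - 1))
abbrev HH (n : ℕ) : Set (EE n) := {p | 0 < p.1}
noncomputable abbrev psi (n : ℕ) (p : EE n) : ℝ := 4 * p.1 / ((1 + p.1) ^ 2 + ‖p.2‖ ^ 2)

instance haar_EE (n : ℕ) : (volume : Measure (EE n)).IsAddHaarMeasure :=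
  inferInstanceAs ((volume : Measure ℝ).prod (volume : Measure (EuclideanSpace ℝ (Fin (n - 1))))).IsAddHaarMeasure

lemma HH_open (n : ℕ) : IsOpen (HH n) := isOpen_lt continuous_const continuous_fst
lemma HH_meas (n : ℕ) : MeasurableSet (HH n) := (HH_open n).measurableSet

lemma psi_pos {n : ℕ} {p : EE n} (hp : p ∈ HH n) : 0 < psi n p := by
  have : 0 < p.1 := hp
  unfold psi; positivity

lemma psi_le_one {n : ℕ} {p : EE n} (hp : p ∈ HH n) : psi n p ≤ 1 := by
  have : 0 < p.1 := hp
  unfold psi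
  rw [div_le_one (by positivity)]
  nlinarith [sq_nonneg (1 - p.1), sq_nonneg ‖p.2‖]

lemma psi_out {n : ℕ} (u : Set (EE n)) (hu : IsOpen u) (h : ((1, 0) : EE n) ∈ u) :
    ∃ t, 0 ≤ t ∧ t < 1 ∧ ∀ x ∈ HH n \ u, psi n x ≤ t := by
  obtain ⟨δ, hδ, hball⟩ := Metric.isOpen_iff.1 hu _ h
  set K : ℝ := 4 * (1 / δ ^ 2 + 1 / δ)
  have hK : 0 < K := by positivity
  refine ⟨K / (1 + K), by positivity, by rw [div_lt_one (by positivity)]; linarith, ?_⟩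
  rintro ⟨t, v⟩ ⟨hx, hxu⟩
  have ht : 0 < t := hx
  have hd : δ ≤ dist ((t, v) : EE n) (1, 0) := by
    by_contra hlt
    exact hxu (hball (by simpa using hlt))
  set N : ℝ := (1 - t) ^ 2 + ‖v‖ ^ 2 with hN
  have hN0 : 0 ≤ N := by positivity
  have hr : δ ≤ √N := by
    apply Real.le_sqrt_of_sq_le
    rw [Prod.dist_eq, le_max_iff, Real.dist_eq, dist_zero_right] at hd
    rcases hd with hd | hd
    · have : δ ^ 2 ≤ |t - 1| ^ 2 := by gcongr
      rw [sq_abs] at this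
      nlinarith [sq_nonneg ‖v‖]
    · have : δ ^ 2 ≤ ‖v‖ ^ 2 := by gcongr
      nlinarith [sq_nonneg (1 - t)]
  have ht1 : t ≤ 1 + √N := by
    have : t - 1 ≤ √N := by
      apply Real.le_sqrt_of_sq_le
      nlinarith [sq_nonneg ‖v‖]
    linarith
  have hsq : √N ^ 2 = N := Real.sq_sqrt hN0
  have h1 : 1 ≤ N * (1 / δ ^ 2) := by
    rw [mul_one_div, le_div_iff₀ (by positivity), ← hsq, one_mul]; gcongr
  have h2 : √N ≤ N * (1 / δ) := by
    rw [mul_one_div, le_div_iff₀ (by positivity)]; nlinarith [Real.sqrt_nonneg N]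
  have h3 : 4 * t ≤ K * N := by
    have : K * N = 4 * (N * (1 / δ ^ 2) + N * (1 / δ)) := by simp only [K]; ring
    linarith
  change 4 * t / ((1 + t) ^ 2 + ‖v‖ ^ 2) ≤ _
  have h4 : (1 + t) ^ 2 + ‖v‖ ^ 2 = N + 4 * t := by rw [hN]; ring
  rw [h4, div_le_div_iff₀ (by positivity) (by positivity)]
  nlinarith

lemma finrank_EE (n : ℕ) (hn : 1 ≤ n) : Module.finrank ℝ (EE n) = n := by
  simp [EE]; omega

/-- the density at exponent `2n` -/
noncomputable abbrev kk (n : ℕ) (p : EE n) : ℝ := psi n p ^ (2 * (n : ℝ)) * p.1 ^ (-(n : ℝ))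

lemma kk_meas (n : ℕ) : Measurable (kk n) := by unfold kk psi; fun_prop

lemma kk_pos {n : ℕ} {p : EE n} (hp : p ∈ HH n) : 0 < kk n p := 
  mul_pos (Real.rpow_pos_of_pos (psi_pos hp) _) (Real.rpow_pos_of_pos hp _)

lemma kk_int (n : ℕ) (hn : 1 ≤ n) : IntegrableOn (kk n) (HH n) := by
  have h0 : Integrable (fun x : EE n => ((1 : ℝ) + ‖x‖ ^ 2) ^ (-(2 * n : ℝ) / 2)) := by
    apply integrable_rpow_neg_one_add_norm_sq
    rw [finrank_EE n hn]
    have : (1 : ℝ) ≤ n := by exact_mod_cast hn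
    linarith
  refine Integrable.mono' ((h0.const_mul (16 ^ (n : ℝ))).integrableOn) 
    (kk_meas n).aestronglyMeasurable ?_
  filter_upwards [ae_restrict_mem (HH_meas n)] with p hp
  rw [Real.norm_of_nonneg (kk_pos hp).le]
  have hp0 : 0 < p.1 := hp
  have e : -(2 * n : ℝ) / 2 = -(n : ℝ) := by ring
  rw [e, Real.rpow_neg (by positivity), ← div_eq_mul_inv, ← Real.div_rpow (by norm_num) (by positivity)]
  have e2 : kk n p = (psi n p ^ 2 / p.1) ^ (n : ℝ) := by
    unfold kk
    rw [Real.rpow_mul (psi_pos hp).le, Real.rpow_neg hp0.le, ← div_eq_mul_inv,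
      ← Real.div_rpow (by positivity) hp0.le]
    norm_num
  rw [e2]
  apply Real.rpow_le_rpow (by positivity) _ (by positivity)
  have hnorm : ‖p‖ ^ 2 ≤ p.1 ^ 2 + ‖p.2‖ ^ 2 := by
    rw [Prod.norm_def]
    rcases max_choice ‖p.1‖ ‖p.2‖ with h | h <;> rw [h]
    · rw [Real.norm_eq_abs, sq_abs]; nlinarith [sq_nonneg ‖p.2‖]
    · nlinarith [sq_nonneg p.1]
  unfold psi
  set D := (1 + p.1) ^ 2 + ‖p.2‖ ^ 2 with hD
  have hD0 : 0 < D := by positivity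
  have hD1 : 1 + ‖p‖ ^ 2 ≤ D := by rw [hD]; nlinarith
  have hD2 : p.1 ≤ D := by rw [hD]; nlinarith [sq_nonneg ‖p.2‖, sq_nonneg p.1]
  calc (4 * p.1 / D) ^ 2 / p.1 = 16 / D * (p.1 / D) := by field_simp; ring
    _ ≤ 16 / D * 1 := by gcongr; exact (div_le_one hD0).2 hD2
    _ ≤ 16 / (1 + ‖p‖ ^ 2) := by rw [mul_one]; gcongr

lemma berezin_peak (n : ℕ) (hn : 1 ≤ n) (g : EE n → ℂ) (hg : Continuous g) (M : ℝ)
    (hM : ∀ x, ‖g x‖ ≤ M) :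
    Tendsto (fun ν : ℝ => (∫ p in HH n, psi n p ^ ν * p.1 ^ (-(n : ℝ)))⁻¹ •
      ∫ p in HH n, (psi n p ^ ν * p.1 ^ (-(n : ℝ))) • g p) atTop (𝓝 (g (1, 0))) := by
  set μ : Measure (EE n) := volume.withDensity (fun p => ((kk n p).toNNReal : ENNReal)) with hμ
  have hkm : Measurable (fun p => (kk n p).toNNReal) := (kk_meas n).real_toNNReal
  have hμs : μ (HH n) ≠ ⊤ := by
    rw [hμ, withDensity_apply _ (HH_meas n)]
    exact (Integrable.lintegral_lt_top (kk_int n hn)).ne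
  have hcont : ContinuousAt (psi n) (1, 0) := by
    apply ContinuousAt.div (by fun_prop) (by fun_prop)
    norm_num
  have := peak_rpow μ (HH n) (HH_meas n) hμs (1, 0) (psi n)
    (by unfold psi; fun_prop) (fun x hx => (psi_pos hx).le) (fun x hx => psi_le_one hx)
    (by norm_num [psi]) hcont psi_out ?_ g ?_ hg.continuousAt
  · have h2 := this.comp (tendsto_atTop_add_const_right atTop (-(2 * (n : ℝ))) tendsto_id)
    refine h2.congr fun ν => ?_
    have hid : ∀ p ∈ HH n, kk n p * psi n p ^ (ν + -(2 * (n : ℝ))) 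
        = psi n p ^ ν * p.1 ^ (-(n : ℝ)) := by
      intro p hp
      unfold kk
      rw [Real.rpow_add (psi_pos hp), Real.rpow_neg (psi_pos hp).le]
      have := (Real.rpow_pos_of_pos (psi_pos hp) (2 * (n:ℝ))).ne'
      field_simp
    simp only [Function.comp, id]
    rw [hμ, setIntegral_withDensity_eq_setIntegral_smul hkm _ (HH_meas n),
      setIntegral_withDensity_eq_setIntegral_smul hkm _ (HH_meas n)]
    congr 1
    · congr 1
      refine setIntegral_congr_fun (HH_meas n) fun p hp => ?_
      simp only [NNReal.smul_def, Real.coe_toNNReal _ (kk_pos hp).le, smul_eq_mul]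
      exact hid p hp
    · refine setIntegral_congr_fun (HH_meas n) fun p hp => ?_
      simp only [NNReal.smul_def, Real.coe_toNNReal _ (kk_pos hp).le, smul_smul]
      rw [hid p hp]
  · intro u hu hxu
    have ho := hu.inter (HH_open n)
    rw [hμ, withDensity_apply _ ho.measurableSet, setLIntegral_pos_iff (by fun_prop)]
    have : u ∩ HH n ⊆ Function.support (fun p => ((kk n p).toNNReal : ENNReal)) ∩ (u ∩ HH n) := by
      intro p hp
      refine ⟨?_, hp⟩
      simp only [Function.mem_support, ne_eq, ENNReal.coe_eq_zero, Real.toNNReal_eq_zero, not_le]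
      exact kk_pos hp.2
    refine lt_of_lt_of_le ?_ (measure_mono this)
    exact ho.measure_pos _ ⟨(1, 0), hxu, by simp [HH]⟩
  · exact Measure.integrableOn_of_bounded hμs hg.aestronglyMeasurable (ae_of_all _ hM)

lemma int_nu (n : ℕ) (hn : 1 ≤ n) (ν : ℝ) (hν : 2 * (n : ℝ) ≤ ν) :
    IntegrableOn (fun p => psi n p ^ ν * p.1 ^ (-(n : ℝ))) (HH n) := by
  refine Integrable.mono' (kk_int n hn) 
    (Measurable.aestronglyMeasurable (by unfold psi; fun_prop)) ?_
  filter_upwards [ae_restrict_mem (HH_meas n)] with p hp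
  have hp0 : 0 < p.1 := hp
  have := Real.rpow_pos_of_pos (psi_pos hp) ν
  rw [Real.norm_of_nonneg (by positivity)]
  unfold kk
  gcongr ?_ * _
  exact Real.rpow_le_rpow_of_exponent_ge (psi_pos hp) (psi_le_one hp) hν

/-- change of variables -/
lemma inner_cov (n : ℕ) (hn : 1 ≤ n) (h : EE n → ℂ) (p : EE n) (hp : 0 < p.1) (ν : ℝ) :
    ∫ q in HH n, ((4 * p.1 * q.1 / ((p.1 + q.1) ^ 2 + ‖p.2 - q.2‖ ^ 2)) ^ ν
        * q.1 ^ (-(n : ℝ))) • h q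
    = ∫ u in HH n, (psi n u ^ ν * u.1 ^ (-(n : ℝ))) • h ((0, p.2) + p.1 • u) := by
  rw [← integral_indicator (HH_meas n), ← integral_indicator (HH_meas n)]
  rw [← integral_add_left_eq_self _ ((0, p.2) : EE n)]
  have := Measure.integral_comp_smul (volume : Measure (EE n)) (fun x => (HH n).indicator (fun q => ((4 * p.1 * q.1 / ((p.1 + q.1) ^ 2 + ‖p.2 - q.2‖ ^ 2)) ^ ν
        * q.1 ^ (-(n : ℝ))) • h q) ((0, p.2) + x)) p.1
  rw [finrank_EE n hn, abs_of_pos (by positivity), eq_inv_smul_iff₀ (by positivity)] at this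
  rw [← this, ← integral_smul]
  congr 1
  ext u
  by_cases hu : u ∈ HH n
  · have hu0 : 0 < u.1 := hu
    have hu' : (0, p.2) + p.1 • u ∈ HH n := by 
      simp only [HH, Set.mem_ofPred_eq, Prod.fst_add, Prod.smul_fst, smul_eq_mul, zero_add]
      positivity
    rw [Set.indicator_of_mem hu, Set.indicator_of_mem hu', smul_smul]
    congr 1
    simp only [Prod.fst_add, Prod.smul_fst, smul_eq_mul, zero_add, Prod.snd_add, Prod.smul_snd,
      sub_add_cancel_left, norm_neg, norm_smul, Real.norm_of_nonneg hp.le]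
    rw [Real.mul_rpow hp.le hu0.le, Real.rpow_neg hp.le, Real.rpow_natCast]
    have : 4 * p.1 * (p.1 * u.1) / ((p.1 + p.1 * u.1) ^ 2 + (p.1 * ‖u.2‖) ^ 2) = psi n u := by
      unfold psi
      have : (1 + u.1) ^ 2 + ‖u.2‖ ^ 2 ≠ 0 := by positivity
      have : (p.1 + p.1 * u.1) ^ 2 + (p.1 * ‖u.2‖) ^ 2 ≠ 0 := by positivity
      field_simp
    rw [this]
    field_simp
  · have hu' : (0, p.2) + p.1 • u ∉ HH n := by 
      simp only [HH, Set.mem_ofPred_eq, Prod.fst_add, Prod.smul_fst, smul_eq_mul, zero_add] at hu ⊢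
      intro h
      exact hu (pos_of_mul_pos_right h hp.le)
    rw [Set.indicator_of_notMem hu, Set.indicator_of_notMem hu', smul_zero]

/-- As `ν → ∞`, the normalized Berezin quadratic form on real hyperbolic `n`-space
(half-space model `H = {x₀ > 0}` with invariant measure `x₀^{−n} dx₀ dx₁`) converges
to the `L²` norm: for compactly supported continuous `f` on `H`,
`(1/I(ν)) ∬ B_ν(x,y) f(x) conj(f(y)) dμ(x) dμ(y) → ∫ |f|² dμ`. -/
theorem berezin_form_tendsto_L2_hyperbolic (n : ℕ) (hn : 1 ≤ n)
    (f : ℝ × EuclideanSpace ℝ (Fin (n - 1)) → ℂ)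
    (hf : Continuous f) (hcs : HasCompactSupport f)
    (hsupp : tsupport f ⊆ {p : ℝ × EuclideanSpace ℝ (Fin (n - 1)) | 0 < p.1}) :
    Tendsto (fun ν : ℝ =>
        (((∫ p in {p : ℝ × EuclideanSpace ℝ (Fin (n - 1)) | 0 < p.1},
            (4 * p.1 / ((1 + p.1) ^ 2 + ‖p.2‖ ^ 2)) ^ ν * p.1 ^ (-(n : ℝ))) : ℝ) : ℂ)⁻¹
          * ∫ p in {p : ℝ × EuclideanSpace ℝ (Fin (n - 1)) | 0 < p.1},
              ∫ q in {q : ℝ × EuclideanSpace ℝ (Fin (n - 1)) | 0 < q.1},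
                ((4 * p.1 * q.1 / ((p.1 + q.1) ^ 2 + ‖p.2 - q.2‖ ^ 2)) ^ ν
                    * p.1 ^ (-(n : ℝ)) * q.1 ^ (-(n : ℝ)))
                  • (f p * (starRingEnd ℂ) (f q)))
      atTop
      (𝓝 (((∫ p in {p : ℝ × EuclideanSpace ℝ (Fin (n - 1)) | 0 < p.1},
        ‖f p‖ ^ 2 * p.1 ^ (-(n : ℝ))) : ℝ) : ℂ)) := by
  obtain ⟨M, hM⟩ := hf.bounded_above_of_compact_support hcs
  have hM0 : 0 ≤ M := (norm_nonneg _).trans (hM 0)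
  -- rewriting of the inner integral
  have hinner : ∀ ν : ℝ, ∀ p ∈ HH n,
      ∫ q in HH n, ((4 * p.1 * q.1 / ((p.1 + q.1) ^ 2 + ‖p.2 - q.2‖ ^ 2)) ^ ν
          * p.1 ^ (-(n : ℝ)) * q.1 ^ (-(n : ℝ))) • (f p * (starRingEnd ℂ) (f q))
      = (((p.1 ^ (-(n : ℝ)) : ℝ) : ℂ) * f p) *
        ∫ u in HH n, (psi n u ^ ν * u.1 ^ (-(n : ℝ))) • 
          (starRingEnd ℂ) (f ((0, p.2) + p.1 • u)) := by
    intro ν p hp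
    rw [← inner_cov n hn (fun q => (starRingEnd ℂ) (f q)) p hp ν, ← integral_const_mul]
    congr 1
    ext q
    simp only [Complex.real_smul]
    push_cast
    ring
  have hlim : ((∫ p in HH n, ‖f p‖ ^ 2 * p.1 ^ (-(n : ℝ)) : ℝ) : ℂ)
      = ∫ p in HH n, (((p.1 ^ (-(n : ℝ)) : ℝ) : ℂ) * f p) * (starRingEnd ℂ) (f p) := by
    rw [← integral_complex_ofReal]
    congr 1
    ext p
    rw [mul_assoc, Complex.mul_conj, Complex.normSq_eq_norm_sq]
    push_cast
    ring
  rw [hlim]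
  refine Tendsto.congr (fun ν => integral_const_mul _ _) ?_
  refine tendsto_integral_filter_of_dominated_convergence
    (fun p => ‖((p.1 ^ (-(n : ℝ)) : ℝ) : ℂ) * f p‖ * M) ?_ ?_ ?_ ?_
  · refine Eventually.of_forall fun ν => ?_
    apply AEStronglyMeasurable.const_mul
    apply StronglyMeasurable.aestronglyMeasurable
    apply StronglyMeasurable.integral_prod_right
    apply Measurable.stronglyMeasurable
    have := hf.measurable
    unfold Function.uncurry
    fun_prop
  · filter_upwards [eventually_ge_atTop (2 * (n : ℝ))] with ν hν
    filter_upwards [ae_restrict_mem (HH_meas n)] with p hp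
    rw [hinner ν p hp, mul_left_comm, norm_mul]
    gcongr
    rw [norm_mul, norm_inv, Complex.norm_real]
    change ‖∫ p in HH n, psi n p ^ ν * p.1 ^ (-(n : ℝ))‖⁻¹ * _ ≤ _
    set I := ∫ p in HH n, psi n p ^ ν * p.1 ^ (-(n : ℝ)) with hI
    have hnn : ∀ p ∈ HH n, 0 ≤ psi n p ^ ν * p.1 ^ (-(n : ℝ)) := fun p hp =>
      mul_nonneg (Real.rpow_nonneg (psi_pos hp).le _) (Real.rpow_nonneg (le_of_lt hp) _)
    have hI0 : 0 ≤ I := setIntegral_nonneg (HH_meas n) hnn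
    rw [Real.norm_of_nonneg hI0]
    have hb : ‖∫ u in HH n, (psi n u ^ ν * u.1 ^ (-(n : ℝ))) • 
          (starRingEnd ℂ) (f ((0, p.2) + p.1 • u))‖ ≤ I * M := by
      rw [hI, ← integral_mul_const]
      refine norm_integral_le_of_norm_le ((int_nu n hn ν hν).mul_const M) ?_
      filter_upwards [ae_restrict_mem (HH_meas n)] with u hu
      rw [norm_smul, Real.norm_of_nonneg (hnn u hu), RCLike.norm_conj]
      exact mul_le_mul_of_nonneg_left (hM _) (hnn u hu)
    calc _ ≤ I⁻¹ * (I * M) := by gcongr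
      _ ≤ M := by
        rw [← mul_assoc]
        exact mul_le_of_le_one_left hM0 (inv_mul_le_one)
  · apply Integrable.mul_const
    apply Integrable.norm
    apply Integrable.integrableOn
    have hk : IsCompact (tsupport f) := hcs
    refine (integrableOn_iff_integrable_of_support_subset (s := tsupport f) ?_).1 ?_
    · intro p hp
      apply subset_tsupport
      intro h0
      exact hp (by simp [h0])
    · refine ContinuousOn.integrableOn_compact hk ?_
      refine ContinuousOn.mul ?_ hf.continuousOn
      refine Complex.continuous_ofReal.comp_continuousOn ?_
      exact ContinuousOn.rpow_const continuous_fst.continuousOn 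
        fun p hp => Or.inl (ne_of_gt (hsupp hp))
  · filter_upwards [ae_restrict_mem (HH_meas n)] with p hp
    have h1 := berezin_peak n hn (fun u => (starRingEnd ℂ) (f ((0, p.2) + p.1 • u)))
      (by fun_prop) M (fun x => by rw [RCLike.norm_conj]; exact hM _)
    have h2 := h1.const_mul (((p.1 ^ (-(n : ℝ)) : ℝ) : ℂ) * f p)
    have e : ((0, p.2) : EE n) + p.1 • ((1, 0) : EE n) = p := by
      ext <;> simp
    simp only [e] at h2
    refine h2.congr fun ν => ?_
    rw [hinner ν p hp, Complex.real_smul, mul_left_comm, Complex.ofReal_inv]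
end
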